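/- Let A ∈ ℝ^{N×N} be symmetric, let σ : Fin N → Fin q be a partition into nonempty clusters of sizes N_k that is equitable for A, let F^1, …, F^q and H be m×m real matrices, and let T ∈ ℝ^{N×N} be orthogonal with a cluster assignment τ : Fin N → Fin q of its rows and an injection ι : Fin q → Fin N such that: (i) τ(ι(k)) = k and row ι(k) of T is the normalized indicator of cluster k (T_{ι(k), j} = 1/√N_k if σ j = k, 0 otherwise); (ii) T_{rj} = 0 whenever τ(r) ≠ σ(j). Let M = ∑_{k=1}^q J^k ⊗ F^k + A ⊗ H (where J^k is the diagonal cluster-indicator matrix), let M̃ = (T ⊗ I_m)·M·(Tᵀ ⊗ I_m), and let M_orth be the (N−q)m × (N−q)m submatrix of M̃ obtained by keeping the m-blocks whose row indices r ∈ Fin N are not in the range of ι. Suppose every complex root of the characteristic polynomial of M_orth has negative real part. Then every solution z : ℝ → (Fin N → ℝ^m) of ż_i = F^{σ i} z_i + ∑_j A_{ij} H z_j achieves group consensus: for all i, j with σ i = σ j, ‖z_i(t) − z_j(t)‖ → 0 as t → ∞, regardless of whether the quotient (parallel) dynamics is stable. -/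

import Mathlib

open Matrix Kronecker Finset Filter

open Topology

/-- A solution of `w' = μ w + v` with `Re μ < 0` and a forcing term `v` that tends to zero
tends to zero. -/
theorem tendsto_zero_of_hasDerivAt_smul_add {E : Type*} [NormedAddCommGroup E] [NormedSpace ℂ E]
    {μ : ℂ} (hμ : μ.re < 0) {w v : ℝ → E}
    (hw : ∀ t, HasDerivAt w (μ • w t + v t) t) (hv : Tendsto v atTop (𝓝 0)) :
    Tendsto w atTop (𝓝 0) := by
  set α : ℝ := -μ.re with hα
  have hα0 : 0 < α := by linarith
  have hnorm : ∀ t : ℝ, ‖Complex.exp (-μ * t)‖ = Real.exp (α * t) := by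
    intro t
    rw [Complex.norm_exp]
    simp [hα]
  set f : ℝ → E := fun t => Complex.exp (-μ * t) • w t with hf
  have hfd : ∀ t : ℝ, HasDerivAt f (Complex.exp (-μ * t) • v t) t := by
    intro t
    have h1 : HasDerivAt (fun t : ℝ => Complex.exp (-μ * t)) (Complex.exp (-μ * t) * (-μ)) t := by
      have h2 : HasDerivAt (fun t : ℝ => -μ * (t : ℂ)) (-μ) t := by
        simpa using (HasDerivAt.ofReal_comp (hasDerivAt_id t)).const_mul (-μ)
      exact h2.cexp
    exact (h1.smul (hw t)).congr_deriv (by module)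
  have hfn : ∀ t, ‖f t‖ = Real.exp (α * t) * ‖w t‖ := by
    intro t
    rw [hf, norm_smul, hnorm]
  rw [Metric.tendsto_atTop]
  intro ε hε
  obtain ⟨a, ha⟩ := Metric.tendsto_atTop.1 hv (α * (ε / 2)) (by positivity)
  have hbound : ∀ t ≥ a, ‖f t‖ ≤ ‖f a‖ + (ε / 2) * (Real.exp (α * t) - Real.exp (α * a)) := by
    intro t ht
    have hB : ∀ x, HasDerivAt
        (fun x => ‖f a‖ + (ε / 2) * (Real.exp (α * x) - Real.exp (α * a)))
        ((ε / 2) * (Real.exp (α * x) * α)) x := by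
      intro x
      have h2 : HasDerivAt (fun x : ℝ => α * x) α x := by
        simpa using (hasDerivAt_id x).const_mul α
      exact ((h2.exp.sub_const _).const_mul _).const_add _
    refine image_norm_le_of_norm_deriv_right_le_deriv_boundary (a := a) (b := t)
      (fun x _ => (hfd x).continuousAt.continuousWithinAt)
      (fun x _ => (hfd x).hasDerivWithinAt) (by simp) hB ?_ ⟨ht, le_rfl⟩
    intro x hx
    have hvx : ‖v x‖ < α * (ε / 2) := by simpa using ha x hx.1
    rw [norm_smul, hnorm]
    calc Real.exp (α * x) * ‖v x‖ ≤ Real.exp (α * x) * (α * (ε / 2)) := by gcongr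
      _ = _ := by ring
  have hdecay : Tendsto (fun t : ℝ => Real.exp (-(α * t)) * ‖f a‖) atTop (𝓝 0) := by
    have h3 : Tendsto (fun t : ℝ => Real.exp (-(α * t))) atTop (𝓝 0) :=
      Real.tendsto_exp_neg_atTop_nhds_zero.comp (tendsto_id.const_mul_atTop hα0)
    simpa using h3.mul_const ‖f a‖
  obtain ⟨b, hb⟩ := Metric.tendsto_atTop.1 hdecay (ε / 2) (by positivity)
  refine ⟨max a b, fun t ht => ?_⟩
  have h4 := hbound t (le_trans (le_max_left _ _) ht)
  have h5 := hb t (le_trans (le_max_right _ _) ht)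
  rw [Real.dist_0_eq_abs] at h5
  replace h5 := lt_of_le_of_lt (le_abs_self _) h5
  rw [hfn t] at h4
  have h6 : Real.exp (-(α * t)) * Real.exp (α * t) = 1 := by
    rw [← Real.exp_add]; simp
  have h7 : ‖w t‖ = Real.exp (-(α * t)) * (Real.exp (α * t) * ‖w t‖) := by
    rw [← mul_assoc, h6, one_mul]
  have h8 : Real.exp (-(α * t)) * (Real.exp (α * t) * ‖w t‖) ≤
      Real.exp (-(α * t)) *
        (‖f a‖ + (ε / 2) * (Real.exp (α * t) - Real.exp (α * a))) := by gcongr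
  have h9 : 0 < Real.exp (-(α * t)) * Real.exp (α * a) := by positivity
  rw [dist_zero_right, h7]
  nlinarith

/-- A solution of `w' = L w` annihilated by a product of factors `L - μ` with `Re μ < 0` tends to
zero. -/
theorem tendsto_zero_of_aeval_prod_eq_zero {E : Type*} [NormedAddCommGroup E] [NormedSpace ℂ E]
    [FiniteDimensional ℂ E] (L : Module.End ℂ E) (s : Multiset ℂ) (hs : ∀ μ ∈ s, μ.re < 0)
    (w : ℝ → E) (hw : ∀ t, HasDerivAt w (L (w t)) t)
    (h : ∀ t, Polynomial.aeval L (s.map fun μ => Polynomial.X - Polynomial.C μ).prod (w t) = 0) :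
    Tendsto w atTop (𝓝 0) := by
  induction s using Multiset.induction_on generalizing w with
  | empty =>
    have hw0 : w = fun _ => 0 := funext fun t => by simpa using h t
    rw [hw0]
    exact tendsto_const_nhds
  | cons μ s ih =>
    have hv : Tendsto (fun t => L (w t) - μ • w t) atTop (𝓝 0) := by
      refine ih (fun ν hν => hs ν (Multiset.mem_cons_of_mem hν)) _ (fun t => ?_) fun t => ?_
      · have h1 : HasDerivAt (fun t => L (w t)) (L (L (w t))) t :=
          (((LinearMap.toContinuousLinearMap L).restrictScalars ℝ).hasFDerivAt).comp_hasDerivAt t (hw t)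
        exact (h1.fun_sub ((hw t).const_smul μ)).congr_deriv (by simp)
      · have h1 := h t
        rw [Multiset.map_cons, Multiset.prod_cons, mul_comm, map_mul, Module.End.mul_apply] at h1
        simpa [Module.algebraMap_end_apply] using h1
    refine tendsto_zero_of_hasDerivAt_smul_add (hs μ (Multiset.mem_cons_self μ s))
      (fun t => ?_) hv
    simpa using hw t

/-- Solutions of `y' = B y` tend to zero when the real matrix `B` is Hurwitz. -/
theorem tendsto_zero_of_hurwitz {n : Type*} [Fintype n] [DecidableEq n] (B : Matrix n n ℝ)
    (hB : ∀ μ : ℂ, (B.charpoly.map (algebraMap ℝ ℂ)).IsRoot μ → μ.re < 0)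
    (y : ℝ → n → ℝ) (hy : ∀ t p, HasDerivAt (fun s => y s p) ((B *ᵥ y t) p) t) (p : n) :
    Tendsto (fun t => y t p) atTop (𝓝 0) := by
  set C : Matrix n n ℂ := B.map (algebraMap ℝ ℂ) with hC
  have hCp : C.charpoly = B.charpoly.map (algebraMap ℝ ℂ) := Matrix.charpoly_map B _
  have hw : Tendsto (fun t p => (y t p : ℂ)) atTop (𝓝 (0 : n → ℂ)) := by
    refine tendsto_zero_of_aeval_prod_eq_zero (Matrix.toLin' C) C.charpoly.roots
      (fun μ hμ => hB μ ?_) _ (fun t => ?_) fun t => ?_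
    · rw [← hCp]
      exact Polynomial.isRoot_of_mem_roots hμ
    · rw [hasDerivAt_pi]
      intro i
      refine (hy t i).ofReal_comp.congr_deriv ?_
      simp [hC, Matrix.mulVec, dotProduct]
    · rw [← (IsAlgClosed.splits C.charpoly).eq_prod_roots_of_monic C.charpoly_monic,
        ← Matrix.charpoly_toLin', LinearMap.aeval_self_charpoly, LinearMap.zero_apply]
  have h1 := (Complex.continuous_re.tendsto _).comp ((tendsto_pi_nhds.1 hw) p)
  simpa [Function.comp_def] using h1

/-- **Main stability claim.** If the orthogonal block of the IRR-transformed
dynamics matrix is Hurwitz (all complex roots of its characteristic polynomial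
have negative real part), then every solution of the network dynamics with
orbit-identical individual dynamics achieves group consensus, regardless of
whether the quotient (parallel) dynamics is stable. -/
theorem stmt_14 (N q m : ℕ) (A : Matrix (Fin N) (Fin N) ℝ) (hA : Aᵀ = A)
    (σ : Fin N → Fin q) (hne : Function.Surjective σ)
    (Q : Matrix (Fin q) (Fin q) ℝ)
    (hQ : ∀ (i : Fin N) (l : Fin q),
      ∑ j ∈ univ.filter (fun j => σ j = l), A i j = Q (σ i) l)
    (F : Fin q → Matrix (Fin m) (Fin m) ℝ) (H : Matrix (Fin m) (Fin m) ℝ)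
    (T : Matrix (Fin N) (Fin N) ℝ) (hT1 : Tᵀ * T = 1) (hT2 : T * Tᵀ = 1)
    (τ : Fin N → Fin q) (ι : Fin q → Fin N) (hι : Function.Injective ι)
    (hτι : ∀ k, τ (ι k) = k)
    (hrow : ∀ (k : Fin q) (j : Fin N), T (ι k) j =
      if σ j = k then 1 / Real.sqrt ((univ.filter (fun i => σ i = k)).card : ℝ) else 0)
    (hsupp : ∀ (r : Fin N) (j : Fin N), τ r ≠ σ j → T r j = 0)
    (J : Fin q → Matrix (Fin N) (Fin N) ℝ)
    (hJ : ∀ k, J k = Matrix.diagonal (fun i => if σ i = k then (1 : ℝ) else 0))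
    (M : Matrix (Fin N × Fin m) (Fin N × Fin m) ℝ)
    (hM : M = ∑ k, J k ⊗ₖ F k + A ⊗ₖ H)
    (Mtil : Matrix (Fin N × Fin m) (Fin N × Fin m) ℝ)
    (hMtil : Mtil = (T ⊗ₖ (1 : Matrix (Fin m) (Fin m) ℝ)) * M *
      (Tᵀ ⊗ₖ (1 : Matrix (Fin m) (Fin m) ℝ)))
    (Morth : Matrix ({r : Fin N // ∀ k, ι k ≠ r} × Fin m)
      ({r : Fin N // ∀ k, ι k ≠ r} × Fin m) ℝ)
    (hMorth : Morth = Mtil.submatrix (fun p => (p.1.1, p.2)) (fun p => (p.1.1, p.2)))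
    (hHurwitz : ∀ μ : ℂ, (Morth.charpoly.map (algebraMap ℝ ℂ)).IsRoot μ → μ.re < 0)
    (z : ℝ → Fin N → (Fin m → ℝ))
    (hz : ∀ (i : Fin N) (t : ℝ), HasDerivAt (fun s => z s i)
      ((F (σ i)).mulVec (z t i) + ∑ j, A i j • H.mulVec (z t j)) t) :
    ∀ i j, σ i = σ j →
      Tendsto (fun t => ‖z t i - z t j‖) atTop (nhds 0) := by
  have horth : ∀ r, (∀ k, ι k ≠ r) → ∀ g : Fin q → ℝ, ∑ i, T r i * g (σ i) = 0 := by
    intro r hr g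
    have hl : ∀ l, ∑ i ∈ univ.filter (fun i => σ i = l), T r i = 0 := by
      intro l
      have h1 : (T * Tᵀ) r (ι l) = 0 := by rw [hT2, Matrix.one_apply_ne (hr l).symm]
      have hpos : 0 < Real.sqrt ((univ.filter (fun i => σ i = l)).card : ℝ) := by
        obtain ⟨i, hi⟩ := hne l
        exact Real.sqrt_pos.2 (Nat.cast_pos.2 (Finset.card_pos.2 ⟨i, by simp [hi]⟩))
      simp only [Matrix.mul_apply, Matrix.transpose_apply, hrow, mul_ite, mul_zero] at h1
      rw [← Finset.sum_filter, ← Finset.sum_mul] at h1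
      exact (mul_eq_zero.1 h1).resolve_right (one_div_pos.2 hpos).ne'
    rw [← Finset.sum_fiberwise univ σ]
    refine Finset.sum_eq_zero fun l _ => ?_
    calc ∑ i ∈ univ.filter (fun i => σ i = l), T r i * g (σ i)
        = ∑ i ∈ univ.filter (fun i => σ i = l), T r i * g l :=
          Finset.sum_congr rfl fun i hi => by rw [(Finset.mem_filter.1 hi).2]
      _ = 0 := by rw [← Finset.sum_mul, hl, zero_mul]
  have hMe : ∀ i a j b, M (i, a) (j, b) =
      (if i = j then F (σ i) a b else 0) + A i j * H a b := by
    intro i a j b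
    simp [hM, hJ, Matrix.sum_apply, Matrix.diagonal_apply, ite_mul]
  have hMtile : ∀ r a s b, Mtil (r, a) (s, b) = ∑ i, T r i * ∑ j, M (i, a) (j, b) * T s j := by
    intro r a s b
    rw [hMtil, Matrix.mul_assoc]
    simp [Matrix.mul_apply, Fintype.sum_prod_type, Matrix.one_apply]
  have hblock : ∀ r, (∀ k, ι k ≠ r) → ∀ a k b, Mtil (r, a) (ι k, b) = 0 := by
    intro r hr a k b
    rw [hMtile]
    set c := 1 / Real.sqrt ((univ.filter (fun i => σ i = k)).card : ℝ)
    refine Eq.trans (Finset.sum_congr rfl fun i _ => ?_)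
      (horth r hr fun l => ((if l = k then F l a b else 0) + Q l k * H a b) * c)
    congr 1
    calc ∑ j, M (i, a) (j, b) * T (ι k) j
        = ∑ j, ((if i = j then if σ i = k then F (σ i) a b * c else 0 else 0) +
            (if σ j = k then A i j else 0) * (H a b * c)) :=
          Finset.sum_congr rfl fun j _ => by
            rw [hMe, hrow]
            by_cases hij : i = j
            · subst hij
              by_cases hik : σ i = k
              · simp only [hik, if_true]
                ring
              · simp [hik]
            · by_cases hjk : σ j = k
              · simp only [hij, hjk, if_true, if_false]
                ring
              · simp [hij, hjk]
      _ = ((if σ i = k then F (σ i) a b else 0) + Q (σ i) k * H a b) * c := by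
          rw [Finset.sum_add_distrib, ← Finset.sum_mul, ← hQ, Finset.sum_filter (s := univ) (p := fun j => σ j = k)]
          simp [add_mul, mul_assoc]
  have hTT : ∀ j j', ∑ s, T s j * T s j' = if j = j' then 1 else 0 := by
    intro j j'
    have h1 := congrFun (congrFun hT1 j) j'
    simpa [Matrix.mul_apply, Matrix.one_apply] using h1
  have hinv : ∀ t j a, z t j a = ∑ s, T s j * ∑ i, T s i * z t i a := by
    intro t j a
    simp only [Finset.mul_sum, ← mul_assoc]
    rw [Finset.sum_comm]
    simp [← Finset.sum_mul, hTT]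
  have hzd : ∀ t i a, HasDerivAt (fun s => z s i a) (∑ j, ∑ b, M (i, a) (j, b) * z t j b) t := by
    intro t i a
    refine (hasDerivAt_pi.1 (hz i t) a).congr_deriv ?_
    have hF : ∑ j, ∑ b, (if i = j then F (σ i) a b else 0) * z t j b =
        ∑ b, F (σ i) a b * z t i b := by
      rw [Finset.sum_comm]
      simp [ite_mul]
    simp only [hMe, add_mul, Finset.sum_add_distrib, hF]
    simp [Matrix.mulVec, dotProduct, Finset.mul_sum, mul_assoc]
  have hy : ∀ t (p : {r : Fin N // ∀ k, ι k ≠ r} × Fin m),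
      HasDerivAt (fun s => ∑ i, T p.1.1 i * z s i p.2)
        ((Morth *ᵥ fun p => ∑ i, T p.1.1 i * z t i p.2) p) t := by
    rintro t ⟨⟨r, hr⟩, a⟩
    refine (HasDerivAt.fun_sum (u := univ)
      fun i _ => (hzd t i a).const_mul (T r i)).congr_deriv (Eq.symm ?_)
    calc (Morth *ᵥ fun p => ∑ i, T p.1.1 i * z t i p.2) (⟨r, hr⟩, a)
        = ∑ s : {r : Fin N // ∀ k, ι k ≠ r},
            ∑ b, Mtil (r, a) (s.1, b) * ∑ i, T s.1 i * z t i b := by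
          simp [hMorth, Matrix.mulVec, dotProduct, Fintype.sum_prod_type]
      _ = ∑ s, ∑ b, Mtil (r, a) (s, b) * ∑ i, T s i * z t i b := by
          refine Fintype.sum_of_injective _ Subtype.val_injective _ _
            (fun s hs => Finset.sum_eq_zero fun b _ => ?_) fun _ => rfl
          have hs' : ¬ ∀ k, ι k ≠ s := fun h => hs ⟨⟨s, h⟩, rfl⟩
          push Not at hs'
          obtain ⟨k, rfl⟩ := hs'
          rw [hblock r hr, zero_mul]
      _ = ∑ i, T r i * ∑ j, ∑ b, M (i, a) (j, b) * z t j b := by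
          simp only [hMtile]
          calc ∑ s, ∑ b, (∑ i, T r i * ∑ j, M (i, a) (j, b) * T s j) * ∑ i, T s i * z t i b
              = ∑ s, ∑ b, ∑ i, ∑ j, T r i * (M (i, a) (j, b) *
                  (T s j * ∑ i, T s i * z t i b)) := by
                refine Finset.sum_congr rfl fun s _ => Finset.sum_congr rfl fun b _ => ?_
                generalize ∑ i, T s i * z t i b = y
                simp only [Finset.sum_mul, Finset.mul_sum, mul_assoc]
            _ = ∑ i, ∑ j, ∑ b, ∑ s, T r i * (M (i, a) (j, b) *
                  (T s j * ∑ i, T s i * z t i b)) :=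
                Finset.sum_comm.trans <| (Finset.sum_congr rfl fun b _ => Finset.sum_comm.trans
                  (Finset.sum_congr rfl fun i _ => Finset.sum_comm)).trans
                  (Finset.sum_comm.trans (Finset.sum_congr rfl fun i _ => Finset.sum_comm))
            _ = ∑ i, T r i * ∑ j, ∑ b, M (i, a) (j, b) * z t j b := by
                simp only [← Finset.mul_sum, ← hinv]
  have hlim : ∀ r, (∀ k, ι k ≠ r) → ∀ a,
      Tendsto (fun t => ∑ i, T r i * z t i a) atTop (𝓝 0) := fun r hr a =>
    tendsto_zero_of_hurwitz Morth hHurwitz (fun t p => ∑ i, T p.1.1 i * z t i p.2) hy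
      (⟨r, hr⟩, a)
  intro i j hij
  have hdiff : Tendsto (fun t => z t i - z t j) atTop (𝓝 0) := by
    rw [tendsto_pi_nhds]
    intro a
    have h1 : ∀ t, (z t i - z t j) a = ∑ s, (T s i - T s j) * ∑ i, T s i * z t i a := by
      intro t
      rw [Pi.sub_apply, hinv t i a, hinv t j a, ← Finset.sum_sub_distrib]
      simp only [sub_mul]
    simp only [h1]
    rw [Pi.zero_apply, ← Finset.sum_const_zero (s := (univ : Finset (Fin N)))]
    refine tendsto_finsetSum _ fun s _ => ?_
    by_cases hs : ∀ k, ι k ≠ s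
    · simpa using (hlim s hs a).const_mul (T s i - T s j)
    · push Not at hs
      obtain ⟨k, rfl⟩ := hs
      simp [hrow, hij]
  simpa using hdiff.norm
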